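/- Let T be a caterpillar on the vertex set {1,…,n} whose body (the path induced on the vertices of degree at least 2) consists of vertices v_1,…,v_r in path order, and for i = 1,…,r let l_i be the number of leaves of T adjacent to v_i. Then the number of permutations that are the product of exactly one edge ordering of T equals 2·∏_{i=1}^{r} l_i! if r > 1, and equals l_1! if r = 1. (Corollary 3.3.) -/

import Mathlib

/-- The transposition of `Sₙ` corresponding to an edge (an unordered pair) of a graph
on the vertex set `Fin n`. -/
def edgePerm {n : ℕ} (e : Sym2 (Fin n)) : Equiv.Perm (Fin n) :=
  Sym2.lift ⟨fun i j => Equiv.swap i j, fun i j => Equiv.swap_comm i j⟩ e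

/-- The product of the transpositions of a list of edges, the first edge applied first. -/
def listProd {n : ℕ} (l : List (Sym2 (Fin n))) : Equiv.Perm (Fin n) :=
  (l.map edgePerm).reverse.prod

/-- `l` is an edge ordering of the graph `T`: a duplicate-free list containing
exactly the edges of `T`. -/
def IsEdgeOrdering {n : ℕ} (T : SimpleGraph (Fin n)) (l : List (Sym2 (Fin n))) : Prop :=
  l.Nodup ∧ ∀ e, e ∈ l ↔ e ∈ T.edgeSet

/-- Two edges meet if they have a common endpoint. -/
def EdgesMeet {V : Type*} (e f : Sym2 V) : Prop := ∃ x, x ∈ e ∧ x ∈ f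

@[simp]
theorem edgePerm_mk {n : ℕ} (a b : Fin n) : edgePerm s(a, b) = Equiv.swap a b := rfl

@[simp]
theorem listProd_cons {n : ℕ} (e : Sym2 (Fin n)) (l : List (Sym2 (Fin n))) :
    listProd (e :: l) = listProd l * edgePerm e := by
  simp [listProd]

theorem listProd_append {n : ℕ} (l l' : List (Sym2 (Fin n))) :
    listProd (l ++ l') = listProd l' * listProd l := by
  simp [listProd]

theorem edgePerm_mul_comm_of_not_meet {n : ℕ} {e f : Sym2 (Fin n)} (h : ¬ EdgesMeet e f) :
    edgePerm e * edgePerm f = edgePerm f * edgePerm e := by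
  induction e with | _ a b
  induction f with | _ c d
  simp only [EdgesMeet, Sym2.mem_iff, not_exists, not_and_or, not_or] at h
  have ha := h a
  have hb := h b
  have hc := h c
  have hd := h d
  simp only [edgePerm_mk]
  ext x
  simp only [Equiv.Perm.mul_apply, Equiv.swap_apply_def]
  grind

/-- The trajectory of a vertex under a product of edge transpositions is a walk using some of
the edges, in order. -/
theorem exists_walk_listProd {n : ℕ} {T : SimpleGraph (Fin n)} (l : List (Sym2 (Fin n)))
    (hl : ∀ e ∈ l, e ∈ T.edgeSet) (x : Fin n) :
    ∃ p : T.Walk x (listProd l x), p.edges.Sublist l := by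
  induction l generalizing x with
  | nil => exact ⟨(SimpleGraph.Walk.nil : T.Walk x x), List.Sublist.refl _⟩
  | cons e l ih =>
    have hl' : ∀ e ∈ l, e ∈ T.edgeSet := fun f hf => hl f (List.mem_cons_of_mem _ hf)
    have hwalk := ih hl' (edgePerm e x)
    rw [listProd_cons, Equiv.Perm.mul_apply]
    by_cases hx : x ∈ e
    · obtain ⟨y, rfl⟩ := hx
      rw [edgePerm_mk, Equiv.swap_apply_left] at hwalk ⊢
      obtain ⟨p, hp⟩ := hwalk
      have hxy : T.Adj x y := hl _ List.mem_cons_self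
      exact ⟨SimpleGraph.Walk.cons hxy p, by simpa using hp⟩
    · have : edgePerm e x = x := by
        induction e with | _ a b
        simp only [Sym2.mem_iff, not_or] at hx
        exact Equiv.swap_apply_of_ne_of_ne hx.1 hx.2
      rw [this] at hwalk ⊢
      obtain ⟨p, hp⟩ := hwalk
      exact ⟨p, hp.trans (List.sublist_cons_self _ _)⟩

theorem walk_eq_of_edges_nodup {V : Type*} {T : SimpleGraph V} (hT : T.IsAcyclic) {x y : V}
    {p q : T.Walk x y} (hp : p.edges.Nodup) (hq : q.edges.Nodup) : p = q := by
  have hp' := (hT.isPath_iff_isTrail p).2 ⟨hp⟩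
  have hq' := (hT.isPath_iff_isTrail q).2 ⟨hq⟩
  exact congrArg Subtype.val ((hT.subsingleton_path x y).elim ⟨p, hp'⟩ ⟨q, hq'⟩)

/-- If consecutive edges of an ordering meet, they occur in the same relative order in every
ordering with the same product. -/
theorem pair_sublist_of_listProd_eq {n : ℕ} {T : SimpleGraph (Fin n)} (hT : T.IsAcyclic)
    {l₁ l₂ l' : List (Sym2 (Fin n))} {e f : Sym2 (Fin n)}
    (hl : IsEdgeOrdering T (l₁ ++ e :: f :: l₂)) (hl' : IsEdgeOrdering T l')
    (hprod : listProd (l₁ ++ e :: f :: l₂) = listProd l') (hef : EdgesMeet e f) :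
    [e, f].Sublist l' := by
  obtain ⟨v, ⟨a, rfl⟩, ⟨b, rfl⟩⟩ := hef
  have hne : s(v, a) ≠ s(v, b) := by
    have := hl.1
    grind
  have hab : a ≠ b := fun h => hne (h ▸ rfl)
  have hva : T.Adj v a := (hl.2 s(v, a)).1 (by simp)
  have hvb : T.Adj v b := (hl.2 s(v, b)).1 (by simp)
  set x := (listProd l₁)⁻¹ a with hx
  have hwalk₁ := exists_walk_listProd (T := T) l₁ (fun e he => (hl.2 e).1 (by simp [he])) x
  obtain ⟨p₂, hp₂⟩ := exists_walk_listProd (T := T) l₂ (fun e he => (hl.2 e).1 (by simp [he])) b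
  have hwalk := exists_walk_listProd (T := T) l' (fun e he => (hl'.2 e).1 he) x
  have h1 : listProd l₁ x = a := by simp [hx]
  have h2 : listProd l' x = listProd l₂ b := by
    rw [← hprod, listProd_append]
    simp only [listProd_cons, edgePerm_mk, Equiv.Perm.mul_apply, h1, Equiv.swap_apply_right]
    rw [Equiv.swap_apply_left]
  rw [h1] at hwalk₁
  rw [h2] at hwalk
  obtain ⟨p₁, hp₁⟩ := hwalk₁
  obtain ⟨q, hq⟩ := hwalk
  let p := p₁.append (SimpleGraph.Walk.cons hva.symm (SimpleGraph.Walk.cons hvb p₂))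
  have hpe : p.edges = p₁.edges ++ s(v, a) :: s(v, b) :: p₂.edges := by
    simp [p, Sym2.eq_swap]
  have hps : p.edges.Sublist (l₁ ++ s(v, a) :: s(v, b) :: l₂) := by
    rw [hpe]
    exact hp₁.append ((hp₂.cons_cons _).cons_cons _)
  have hpq : p = q := walk_eq_of_edges_nodup hT (hl.1.sublist hps) (hl'.1.sublist hq)
  rw [← hpq, hpe] at hq
  refine List.Sublist.trans ?_ hq
  refine List.Sublist.trans ?_ (List.sublist_append_right _ _)
  exact ((List.nil_sublist _).cons_cons _).cons_cons _

theorem eq_of_consecutive_pair_sublist {α : Type*} [DecidableEq α] {l l' : List α}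
    (hl' : l'.Nodup) (hperm : l.Perm l')
    (h : ∀ l₁ l₂ e f, l = l₁ ++ e :: f :: l₂ → [e, f].Sublist l') : l = l' := by
  have key : ∀ e f, [e, f].Sublist l' → l'.idxOf e < l'.idxOf f := by
    intro e f hef
    obtain ⟨s, t, rfl, hs, ht⟩ := List.cons_sublist_iff.1 hef
    rw [List.singleton_sublist] at ht
    have hfs : f ∉ s := fun hf => (List.disjoint_of_nodup_append hl') hf ht
    rw [List.idxOf_append_of_mem hs, List.idxOf_append_of_notMem hfs]
    have := List.idxOf_lt_length_of_mem hs
    omega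
  have hchain : l.IsChain (fun e f => l'.idxOf e < l'.idxOf f) :=
    List.isChain_iff_forall_rel_of_append_cons_cons.2 fun _ _ _ _ heq => key _ _ (h _ _ _ _ heq)
  have htrans : IsTrans α (fun e f => l'.idxOf e < l'.idxOf f) := ⟨fun _ _ _ => lt_trans⟩
  have hpw := List.isChain_iff_pairwise.1 hchain
  have hpw' : l'.Pairwise (fun e f => l'.idxOf e < l'.idxOf f) := by
    rw [List.pairwise_iff_forall_sublist]
    exact fun {e f} hef => key e f hef
  exact hperm.eq_of_pairwise (fun a b _ _ hab hba => absurd hab (lt_asymm hba)) hpw hpw'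

theorem IsEdgeOrdering.perm {n : ℕ} {T : SimpleGraph (Fin n)} {l l' : List (Sym2 (Fin n))}
    (hl : IsEdgeOrdering T l) (hl' : IsEdgeOrdering T l') : l.Perm l' :=
  (List.perm_ext_iff_of_nodup hl.1 hl'.1).2 fun e => (hl.2 e).trans (hl'.2 e).symm

theorem IsEdgeOrdering.of_perm {n : ℕ} {T : SimpleGraph (Fin n)} {l l' : List (Sym2 (Fin n))}
    (hl : IsEdgeOrdering T l) (h : l.Perm l') : IsEdgeOrdering T l' :=
  ⟨h.nodup_iff.1 hl.1, fun e => h.mem_iff.symm.trans (hl.2 e)⟩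

/-- An edge ordering of a forest is the only one with its product iff consecutive edges meet. -/
theorem isChain_meet_iff_unique {n : ℕ} {T : SimpleGraph (Fin n)} (hT : T.IsAcyclic)
    {l : List (Sym2 (Fin n))} (hl : IsEdgeOrdering T l) :
    l.IsChain EdgesMeet ↔ ∀ l', IsEdgeOrdering T l' → listProd l' = listProd l → l' = l := by
  constructor
  · intro hc l' hl' hprod
    refine (eq_of_consecutive_pair_sublist hl'.1 (hl.perm hl') ?_).symm
    rintro l₁ l₂ e f rfl
    exact pair_sublist_of_listProd_eq hT hl hl' hprod.symm
      (List.isChain_iff_forall_rel_of_append_cons_cons.1 hc rfl)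
  · intro hu
    refine List.isChain_iff_forall_rel_of_append_cons_cons.2 ?_
    rintro e f l₁ l₂ rfl
    by_contra hef
    have hswap := hu (l₁ ++ f :: e :: l₂)
      (hl.of_perm ((List.Perm.swap _ _ _).append_left _)) (by
        simp only [listProd_append, listProd_cons, mul_assoc]
        rw [← mul_assoc (edgePerm e), edgePerm_mul_comm_of_not_meet hef, mul_assoc])
    have hnd := (List.nodup_append'.1 hl.1).2.1
    obtain ⟨rfl, -⟩ := List.cons_eq_cons.1 (List.append_cancel_left hswap)
    simp at hnd

theorem ncard_existsUnique_edgeOrdering {n : ℕ} {T : SimpleGraph (Fin n)} (hT : T.IsAcyclic) :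
    {c : Equiv.Perm (Fin n) | ∃! l, IsEdgeOrdering T l ∧ listProd l = c}.ncard =
      {l | IsEdgeOrdering T l ∧ l.IsChain EdgesMeet}.ncard := by
  have himage : {c : Equiv.Perm (Fin n) | ∃! l, IsEdgeOrdering T l ∧ listProd l = c} =
      listProd '' {l | IsEdgeOrdering T l ∧ l.IsChain EdgesMeet} := by
    ext c
    constructor
    · rintro ⟨l, ⟨hl, rfl⟩, hu⟩
      exact ⟨l, ⟨hl, (isChain_meet_iff_unique hT hl).2 fun l' h h' => hu l' ⟨h, h'⟩⟩, rfl⟩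
    · rintro ⟨l, ⟨hl, hc⟩, rfl⟩
      exact ⟨l, ⟨hl, rfl⟩, fun l' h => (isChain_meet_iff_unique hT hl).1 hc l' h.1 h.2⟩
  rw [himage]
  refine Set.InjOn.ncard_image fun l hl l' hl' h => ?_
  exact (isChain_meet_iff_unique hT hl'.1).1 hl'.2 l hl.1 h

/-- The duplicate-free lists of the elements of `S` along which `ρ` is weakly increasing. -/
def sortedOrderings {α : Type*} (ρ : α → ℕ) (S : Finset α) : Set (List α) :=
  {l | l.Nodup ∧ (∀ e, e ∈ l ↔ e ∈ S) ∧ l.Pairwise (fun e f => ρ e ≤ ρ f)}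

theorem ncard_nodup_lists {α : Type*} (S : Finset α) :
    {l : List α | l.Nodup ∧ ∀ e, e ∈ l ↔ e ∈ S}.ncard = S.card.factorial := by
  classical
  have h : {l : List α | l.Nodup ∧ ∀ e, e ∈ l ↔ e ∈ S} = S.toList.permutations.toFinset := by
    ext l
    simp only [Set.mem_ofPred_eq, List.coe_toFinset, List.mem_permutations]
    constructor
    · rintro ⟨h1, h2⟩
      exact (List.perm_ext_iff_of_nodup h1 S.nodup_toList).2 (by simpa using h2)
    · intro h
      exact ⟨h.nodup_iff.2 S.nodup_toList, fun e => by rw [h.mem_iff]; simp⟩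
  rw [h, Set.ncard_coe_finset, List.toFinset_card_of_nodup, List.length_permutations,
    Finset.length_toList]
  exact List.nodup_permutations _ S.nodup_toList

theorem filter_append_filter_of_sorted {α : Type*} (ρ : α → ℕ) (N : ℕ) (l : List α)
    (hl : l.Pairwise (fun e f => ρ e ≤ ρ f)) :
    l.filter (fun e => ρ e < N) ++ l.filter (fun e => ¬ ρ e < N) = l := by
  induction l with
  | nil => rfl
  | cons a l ih =>
    rw [List.pairwise_cons] at hl
    by_cases ha : ρ a < N
    · have := ih hl.2
      simp_all
    · have h1 : l.filter (fun e => ρ e < N) = [] := by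
        rw [List.filter_eq_nil_iff]
        intro e he
        have := hl.1 e he
        simpa using by omega
      have h2 := ih hl.2
      rw [h1, List.nil_append] at h2
      rw [List.filter_cons_of_neg (by simpa using ha), h1, List.nil_append,
        List.filter_cons_of_pos (by simpa using ha), h2]

/-- Sorted orderings are obtained by ordering every fibre of `ρ` independently. -/
theorem ncard_sortedOrderings {α : Type*} (ρ : α → ℕ) (N : ℕ) (S : Finset α)
    (hS : ∀ e ∈ S, ρ e < N) :
    (sortedOrderings ρ S).ncard =
      ∏ k ∈ Finset.range N, (S.filter (fun e => ρ e = k)).card.factorial := by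
  classical
  induction N generalizing S with
  | zero =>
    have hS0 : S = ∅ := Finset.eq_empty_of_forall_notMem fun e he => by simpa using hS e he
    have : sortedOrderings ρ S = {[]} := by
      ext l
      simp only [sortedOrderings, hS0, Set.mem_ofPred_eq, Set.mem_singleton_iff]
      constructor
      · rintro ⟨-, h, -⟩
        exact List.eq_nil_iff_forall_not_mem.2 (by simpa using h)
      · rintro rfl
        simp
    simp [this]
  | succ N ih =>
    set A := S.filter (fun e => ρ e < N) with hA
    set B := S.filter (fun e => ρ e = N) with hB
    have hprod : sortedOrderings ρ S = (fun p : List α × List α => p.1 ++ p.2) ''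
        (sortedOrderings ρ A ×ˢ {l | l.Nodup ∧ ∀ e, e ∈ l ↔ e ∈ B}) := by
      ext l
      constructor
      · rintro ⟨h1, h2, h3⟩
        refine ⟨(l.filter (fun e => ρ e < N), l.filter (fun e => ¬ ρ e < N)), ⟨⟨h1.filter _, ?_,
          h3.filter _⟩, h1.filter _, ?_⟩, filter_append_filter_of_sorted ρ N l h3⟩
        · intro e
          simp [hA, h2]
        · intro e
          simp only [List.mem_filter, h2, hB, Finset.mem_filter, decide_eq_true_eq]
          constructor
          · rintro ⟨h, h'⟩
            have := hS e h
            exact ⟨h, by omega⟩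
          · rintro ⟨h, h'⟩
            exact ⟨h, by omega⟩
      · rintro ⟨⟨a, b⟩, ⟨⟨h1, h2, h3⟩, h4, h5⟩, rfl⟩
        refine ⟨List.nodup_append'.2 ⟨h1, h4, ?_⟩, ?_, List.pairwise_append.2 ⟨h3, ?_, ?_⟩⟩
        · intro e he he'
          have := (h2 e).1 he
          have := (h5 e).1 he'
          grind
        · intro e
          have := hS e
          simp only [List.mem_append, h2, h5, hA, hB, Finset.mem_filter]
          grind
        · refine List.pairwise_of_forall_mem_list ?_
          intro e he f hf
          have := (h5 e).1 he
          have := (h5 f).1 hf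
          grind
        · intro e he f hf
          have := (h2 e).1 he
          have := (h5 f).1 hf
          grind
    rw [hprod, Set.InjOn.ncard_image, Set.ncard_prod, Finset.prod_range_succ,
      ncard_nodup_lists, ih A (fun e he => (Finset.mem_filter.1 he).2)]
    · congr 1
      refine Finset.prod_congr rfl fun k hk => ?_
      have := Finset.mem_range.1 hk
      congr 2
      ext e
      simp only [hA, Finset.mem_filter]
      grind
    · rintro ⟨a, b⟩ ⟨⟨h1, h2, h3⟩, h4, h5⟩ ⟨a', b'⟩ ⟨⟨h1', h2', h3'⟩, h4', h5'⟩ heq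
      have hlen : a.length = a'.length :=
        ((List.perm_ext_iff_of_nodup h1 h1').2 fun e => (h2 e).trans (h2' e).symm).length_eq
      obtain ⟨rfl, rfl⟩ := List.append_inj heq hlen
      rfl

/-- No odd number lies strictly between `a` and `b`. -/
def NoOddBetween (a b : ℕ) : Prop :=
  ∀ i, ¬ (a < 2 * i + 1 ∧ 2 * i + 1 < b) ∧ ¬ (b < 2 * i + 1 ∧ 2 * i + 1 < a)

theorem NoOddBetween.symm {a b : ℕ} (h : NoOddBetween a b) : NoOddBetween b a :=
  fun i => (h i).symm

/-- A list that never jumps over an odd rank and avoids rank `2 * i + 1` stays on one side. -/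
theorem same_side_of_isChain {α : Type*} {ρ : α → ℕ} {l : List α} {i : ℕ}
    (hc : l.IsChain (fun e f => NoOddBetween (ρ e) (ρ f)))
    (hi : ∀ e ∈ l, ρ e ≠ 2 * i + 1) :
    (∀ e ∈ l, ρ e < 2 * i + 1) ∨ (∀ e ∈ l, 2 * i + 1 < ρ e) := by
  induction l with
  | nil => simp
  | cons a l ih =>
    cases l with
    | nil =>
      have := hi a (by simp)
      simp only [List.mem_singleton, forall_eq]
      omega
    | cons b l =>
      rw [List.isChain_cons_cons] at hc
      have hab := hc.1 i
      have ha := hi a (by simp)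
      have hb := hi b (by simp)
      rcases ih hc.2 (fun e he => hi e (List.mem_cons_of_mem _ he)) with h | h
      · left
        have := h b (by simp)
        rintro e (_ | ⟨_, he⟩)
        · omega
        · exact h e he
      · right
        have := h b (by simp)
        rintro e (_ | ⟨_, he⟩)
        · omega
        · exact h e he

theorem isChain_of_sorted {α : Type*} {ρ : α → ℕ} {r : ℕ} {l : List α}
    (hlt : ∀ e ∈ l, ρ e + 2 ≤ 2 * r) (hex : ∀ i, i + 1 < r → ∃ e ∈ l, ρ e = 2 * i + 1)
    (hl : l.Pairwise (fun e f => ρ e ≤ ρ f)) :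
    l.IsChain (fun e f => NoOddBetween (ρ e) (ρ f)) := by
  refine List.isChain_iff_forall_rel_of_append_cons_cons.2 ?_
  rintro e f l₁ l₂ rfl i
  have hf := hlt f (by simp)
  simp only [List.pairwise_append, List.pairwise_cons, List.mem_cons] at hl
  obtain ⟨-, ⟨he, hf', -⟩, hl₁⟩ := hl
  have hef := he f (by simp)
  refine ⟨fun ⟨h1, h2⟩ => ?_, by omega⟩
  obtain ⟨b, hb, hbi⟩ := hex i (by omega)
  simp only [List.mem_append, List.mem_cons] at hb
  rcases hb with hb | rfl | rfl | hb
  · have := hl₁ b hb e (by simp)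
    omega
  · omega
  · omega
  · have := hf' b hb
    omega

theorem crossing_of_isChain {α : Type*} {ρ : α → ℕ} {l : List α} {i : ℕ} {x y b : α}
    (huniq : ∀ e ∈ l, ∀ f ∈ l, ρ e = 2 * i + 1 → ρ f = 2 * i + 1 → e = f)
    (hx : x ∈ l) (hy : y ∈ l) (hb : b ∈ l) (hxi : ρ x < 2 * i + 1) (hyi : 2 * i + 1 < ρ y)
    (hbi : ρ b = 2 * i + 1) (hnd : l.Nodup)
    (hc : l.IsChain (fun e f => NoOddBetween (ρ e) (ρ f))) :
    l.Pairwise (fun e f => ¬ (ρ f ≤ 2 * i + 1 ∧ 2 * i + 1 ≤ ρ e)) ∨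
    l.Pairwise (fun e f => ¬ (ρ e ≤ 2 * i + 1 ∧ 2 * i + 1 ≤ ρ f)) := by
  obtain ⟨s, t, rfl⟩ := List.append_of_mem hb
  have hbs : b ∉ s := fun h => List.disjoint_of_nodup_append hnd h (by simp)
  have hbt : b ∉ t := (List.nodup_cons.1 (List.nodup_append'.1 hnd).2.1).1
  have hs : ∀ e ∈ s, ρ e ≠ 2 * i + 1 := fun e he h =>
    hbs (huniq e (by simp [he]) b hb h hbi ▸ he)
  have ht : ∀ e ∈ t, ρ e ≠ 2 * i + 1 := fun e he h =>
    hbt (huniq e (by simp [he]) b hb h hbi ▸ he)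
  have hxb : x ≠ b := by rintro rfl; omega
  have hyb : y ≠ b := by rintro rfl; omega
  simp only [List.mem_append, List.mem_cons, hxb, hyb, false_or] at hx hy
  have key : ((∀ e ∈ s, ρ e < 2 * i + 1) ∧ ∀ e ∈ t, 2 * i + 1 < ρ e) ∨
      ((∀ e ∈ t, ρ e < 2 * i + 1) ∧ ∀ e ∈ s, 2 * i + 1 < ρ e) := by
    have hct := (List.isChain_append.1 hc).2.1
    rcases same_side_of_isChain (List.isChain_append.1 hc).1 hs with h | h <;>
    rcases same_side_of_isChain hct.tail ht with h' | h'
    · rcases hy with hy | hy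
      · have := h y hy
        omega
      · have := h' y hy
        omega
    · exact .inl ⟨h, h'⟩
    · exact .inr ⟨h', h⟩
    · rcases hx with hx | hx
      · have := h x hx
        omega
      · have := h' x hx
        omega
  simp only [List.pairwise_append, List.pairwise_cons]
  refine key.imp ?_ ?_ <;> rintro ⟨h, h'⟩
  · refine ⟨List.pairwise_of_forall_mem_list fun e he f hf => ?_, ⟨fun e he => ?_,
      List.pairwise_of_forall_mem_list fun e he f hf => ?_⟩, fun e he f hf => ?_⟩
    · have := h e he
      omega
    · have := h' e he
      omega
    · have := h' f hf
      omega
    · have := h e he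
      omega
  · refine ⟨List.pairwise_of_forall_mem_list fun e he f hf => ?_, ⟨fun e he => ?_,
      List.pairwise_of_forall_mem_list fun e he f hf => ?_⟩, fun e he f hf => ?_⟩
    · have := h' e he
      omega
    · have := h e he
      omega
    · have := h f hf
      omega
    · have := h' e he
      omega

/-- A list that meets all odd ranks, each exactly once, and never jumps over an odd rank, is
monotone. -/
theorem sorted_or_sorted_of_isChain {α : Type*} {ρ : α → ℕ} {r : ℕ} {l : List α} {x y : α}
    (hnd : l.Nodup) (hlt : ∀ e ∈ l, ρ e + 2 ≤ 2 * r)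
    (hex : ∀ i, i + 1 < r → ∃ e ∈ l, ρ e = 2 * i + 1)
    (huniq : ∀ i, ∀ e ∈ l, ∀ f ∈ l, ρ e = 2 * i + 1 → ρ f = 2 * i + 1 → e = f)
    (hr : 1 < r) (hx : x ∈ l) (hy : y ∈ l) (hx0 : ρ x = 0) (hyr : ρ y + 2 = 2 * r)
    (hc : l.IsChain (fun e f => NoOddBetween (ρ e) (ρ f))) :
    l.Pairwise (fun e f => ρ e ≤ ρ f) ∨ l.Pairwise (fun e f => ρ f ≤ ρ e) := by
  have hcross : ∀ i, i + 1 < r →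
      l.Pairwise (fun e f => ¬ (ρ f ≤ 2 * i + 1 ∧ 2 * i + 1 ≤ ρ e)) ∨
      l.Pairwise (fun e f => ¬ (ρ e ≤ 2 * i + 1 ∧ 2 * i + 1 ≤ ρ f)) := by
    intro i hi
    obtain ⟨b, hb, hbi⟩ := hex i hi
    exact crossing_of_isChain (huniq i) hx hy hb (by omega) (by omega) hbi hnd hc
  have hxy : x ≠ y := by rintro rfl; omega
  have hconsistent : ∀ i j, i + 1 < r → j + 1 < r →
      l.Pairwise (fun e f => ¬ (ρ f ≤ 2 * i + 1 ∧ 2 * i + 1 ≤ ρ e)) →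
      ¬ l.Pairwise (fun e f => ¬ (ρ e ≤ 2 * j + 1 ∧ 2 * j + 1 ≤ ρ f)) := by
    intro i j hi hj h1 h2
    have h3 := (h1.and h2).imp (S := fun e f => ¬ (e = x ∧ f = y) ∧ ¬ (e = y ∧ f = x)) (by
      rintro e f ⟨h, h'⟩
      constructor <;> rintro ⟨rfl, rfl⟩ <;> omega)
    have : Std.Symm (fun e f => ¬ (e = x ∧ f = y) ∧ ¬ (e = y ∧ f = x)) :=
      ⟨fun e f h => ⟨fun h' => h.2 h'.symm, fun h' => h.1 h'.symm⟩⟩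
    exact (h3.forall hx hy hxy).1 ⟨rfl, rfl⟩
  rcases hcross 0 (by omega) with h0 | h0
  · left
    rw [List.pairwise_iff_forall_sublist]
    intro e f hef
    by_contra hlt'
    have he := hlt e (hef.subset (by simp))
    have hi : (ρ e - 1) / 2 + 1 < r := by omega
    rcases hcross _ hi with h | h
    · have := List.pairwise_iff_forall_sublist.1 h hef
      omega
    · exact hconsistent _ _ (by omega) hi h0 h
  · right
    rw [List.pairwise_iff_forall_sublist]
    intro e f hef
    by_contra hlt'
    have hf := hlt f (hef.subset (by simp))
    have hi : (ρ f - 1) / 2 + 1 < r := by omega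
    rcases hcross _ hi with h | h
    · exact hconsistent _ _ hi (by omega) h h0
    · have := List.pairwise_iff_forall_sublist.1 h hef
      omega

theorem ncard_sortedOrderings_eq_prod_even {α : Type*} (ρ : α → ℕ) (r : ℕ) (S : Finset α)
    (hlt : ∀ e ∈ S, ρ e + 2 ≤ 2 * r)
    (huniq : ∀ i, ∀ e ∈ S, ∀ f ∈ S, ρ e = 2 * i + 1 → ρ f = 2 * i + 1 → e = f) :
    (sortedOrderings ρ S).ncard =
      ∏ i ∈ Finset.range r, (S.filter (fun e => ρ e = 2 * i)).card.factorial := by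
  rw [ncard_sortedOrderings ρ (2 * r) S (fun e he => by have := hlt e he; omega)]
  clear hlt
  induction r with
  | zero => simp
  | succ r ih =>
    rw [Nat.mul_succ, Finset.prod_range_succ, Finset.prod_range_succ, Finset.prod_range_succ, ih]
    have hcard : (S.filter (fun e => ρ e = 2 * r + 1)).card ≤ 1 := by
      rw [Finset.card_le_one]
      intro e he f hf
      rw [Finset.mem_filter] at he hf
      exact huniq r e he.1 f hf.1 he.2 hf.2
    rw [Nat.factorial_eq_one.2 hcard, mul_one]

/-- Monotone orderings and their reversals exhaust the orderings that never jump over an odd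
rank. -/
theorem ncard_isChain_noOddBetween {α : Type*} (ρ : α → ℕ) (r : ℕ) (hr : 0 < r) (S : Finset α)
    (hlt : ∀ e ∈ S, ρ e + 2 ≤ 2 * r)
    (hex : ∀ i, i + 1 < r → ∃ e ∈ S, ρ e = 2 * i + 1)
    (huniq : ∀ i, ∀ e ∈ S, ∀ f ∈ S, ρ e = 2 * i + 1 → ρ f = 2 * i + 1 → e = f)
    (hfirst : 1 < r → ∃ x ∈ S, ρ x = 0) (hlast : 1 < r → ∃ y ∈ S, ρ y + 2 = 2 * r) :
    {l : List α | (l.Nodup ∧ ∀ e, e ∈ l ↔ e ∈ S) ∧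
        l.IsChain (fun e f => NoOddBetween (ρ e) (ρ f))}.ncard =
      if 1 < r then 2 * ∏ i ∈ Finset.range r, (S.filter (fun e => ρ e = 2 * i)).card.factorial
      else (S.filter (fun e => ρ e = 0)).card.factorial := by
  have hsub : ∀ l ∈ sortedOrderings ρ S,
      l.IsChain (fun e f => NoOddBetween (ρ e) (ρ f)) := by
    rintro l ⟨h1, h2, h3⟩
    refine isChain_of_sorted (r := r) (fun e he => hlt e ((h2 e).1 he)) (fun i hi => ?_) h3
    obtain ⟨e, he, hei⟩ := hex i hi
    exact ⟨e, (h2 e).2 he, hei⟩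
  have hcount := ncard_sortedOrderings_eq_prod_even ρ r S hlt huniq
  split_ifs with h
  · obtain ⟨x, hx, hx0⟩ := hfirst h
    obtain ⟨y, hy, hyr⟩ := hlast h
    have hunion : {l : List α | (l.Nodup ∧ ∀ e, e ∈ l ↔ e ∈ S) ∧
        l.IsChain (fun e f => NoOddBetween (ρ e) (ρ f))} =
        sortedOrderings ρ S ∪ List.reverse '' sortedOrderings ρ S := by
      ext l
      constructor
      · rintro ⟨⟨h1, h2⟩, hc⟩
        have := sorted_or_sorted_of_isChain h1 (fun e he => hlt e ((h2 e).1 he))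
          (fun i hi => by simpa [h2] using hex i hi)
          (fun i e he f hf => huniq i e ((h2 e).1 he) f ((h2 f).1 hf)) h ((h2 x).2 hx)
          ((h2 y).2 hy) hx0 hyr hc
        refine this.imp (fun hs => ⟨h1, h2, hs⟩) (fun hs => ⟨l.reverse, ⟨?_, ?_, ?_⟩, ?_⟩)
        · simpa using h1
        · simpa using h2
        · rwa [List.pairwise_reverse]
        · simp
      · rintro (hl | ⟨l, hl, rfl⟩)
        · exact ⟨⟨hl.1, hl.2.1⟩, hsub l hl⟩
        · refine ⟨⟨by simpa using hl.1, by simpa using hl.2.1⟩, ?_⟩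
          rw [List.isChain_reverse]
          exact (hsub l hl).imp fun _ _ => NoOddBetween.symm
    have hdisj : Disjoint (sortedOrderings ρ S) (List.reverse '' sortedOrderings ρ S) := by
      rw [Set.disjoint_left]
      rintro _ hl ⟨l, hl', rfl⟩
      have h2 := (List.pairwise_reverse.1 hl.2.2).and hl'.2.2
      have h3 := h2.imp (S := fun e f => ρ e = ρ f) (fun h => le_antisymm h.2 h.1)
      have : Std.Symm (fun e f => ρ e = ρ f) := ⟨fun _ _ => Eq.symm⟩
      have hxy : x ≠ y := by rintro rfl; omega
      have := h3.forall ((hl'.2.1 x).2 hx) ((hl'.2.1 y).2 hy) hxy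
      omega
    have hfin : (sortedOrderings ρ S).Finite :=
      Set.finite_of_ncard_ne_zero (by
        rw [hcount]
        exact Finset.prod_ne_zero_iff.2 fun i _ => Nat.factorial_ne_zero _)
    rw [hunion, Set.ncard_union_eq hdisj hfin (hfin.image _),
      Set.InjOn.ncard_image List.reverse_injective.injOn, hcount, two_mul]
  · obtain rfl : r = 1 := by omega
    rw [Finset.prod_range_one, mul_zero] at hcount
    rw [← hcount]
    congr 1
    ext l
    constructor
    · rintro ⟨⟨h1, h2⟩, -⟩
      refine ⟨h1, h2, List.pairwise_of_forall_mem_list fun e he f hf => ?_⟩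
      have := hlt e ((h2 e).1 he)
      omega
    · exact fun hl => ⟨⟨hl.1, hl.2.1⟩, hsub l hl⟩

theorem eq_of_adj_of_ncard_eq_one {V : Type*} {T : SimpleGraph V} {w a b : V}
    (hw : (T.neighborSet w).ncard = 1) (ha : T.Adj w a) (hb : T.Adj w b) : a = b := by
  obtain ⟨c, hc⟩ := Set.ncard_eq_one.1 hw
  have ha' : a ∈ T.neighborSet w := ha
  have hb' : b ∈ T.neighborSet w := hb
  rw [hc, Set.mem_singleton_iff] at ha' hb'
  rw [ha', hb']

/-- In a connected graph with a vertex of degree at least two, no edge joins two leaves. -/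
theorem not_adj_of_leaves {V : Type*} {T : SimpleGraph V} (hT : T.Connected) {x y z : V}
    (hx : (T.neighborSet x).ncard = 1) (hy : (T.neighborSet y).ncard = 1)
    (hz : 2 ≤ (T.neighborSet z).ncard) : ¬ T.Adj x y := by
  intro hxy
  have hclosed : ∀ u w, T.Walk u w → (u = x ∨ u = y) → (w = x ∨ w = y) := by
    intro u w p
    induction p with
    | nil => exact id
    | cons h _ ih =>
      rintro (rfl | rfl)
      · exact ih (.inr (eq_of_adj_of_ncard_eq_one hx h hxy))
      · exact ih (.inl (eq_of_adj_of_ncard_eq_one hy h hxy.symm))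
  obtain ⟨p⟩ := hT.preconnected x z
  rcases hclosed x z p (.inl rfl) with rfl | rfl <;> omega

section Caterpillar

variable {n r : ℕ} {T : SimpleGraph (Fin n)} {v : Fin r → Fin n}

theorem ncard_eq_one_of_adj_of_notMem_range
    (hbody : Set.range v = {w : Fin n | 2 ≤ (T.neighborSet w).ncard}) {x y : Fin n}
    (hxy : T.Adj x y) (hx : x ∉ Set.range v) : (T.neighborSet x).ncard = 1 := by
  rw [hbody, Set.mem_ofPred_eq] at hx
  have : 0 < (T.neighborSet x).ncard := (Set.ncard_pos (Set.toFinite _)).2 ⟨y, hxy⟩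
  omega

theorem ncard_body (hbody : Set.range v = {w : Fin n | 2 ≤ (T.neighborSet w).ncard}) (i : Fin r) :
    2 ≤ (T.neighborSet (v i)).ncard := by
  have : v i ∈ Set.range v := ⟨i, rfl⟩
  rwa [hbody] at this

/-- Every edge of a caterpillar is a leaf edge or an edge of the body. -/
theorem caterpillar_edge_cases (hr : 0 < r) (hT : T.Connected)
    (hbody : Set.range v = {w : Fin n | 2 ≤ (T.neighborSet w).ncard})
    (hadj : ∀ i j : Fin r, T.Adj (v i) (v j) ↔ (i.val + 1 = j.val ∨ j.val + 1 = i.val))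
    {e : Sym2 (Fin n)} (he : e ∈ T.edgeSet) :
    (∃ i w, T.Adj (v i) w ∧ (T.neighborSet w).ncard = 1 ∧ e = s(v i, w)) ∨
      ∃ i j : Fin r, i.val + 1 = j.val ∧ e = s(v i, v j) := by
  induction e with | _ x y
  have hxy : T.Adj x y := he
  by_cases hx : x ∈ Set.range v <;> by_cases hy : y ∈ Set.range v
  · obtain ⟨i, rfl⟩ := hx
    obtain ⟨j, rfl⟩ := hy
    right
    rcases (hadj i j).1 hxy with h | h
    · exact ⟨i, j, h, rfl⟩
    · exact ⟨j, i, h, Sym2.eq_swap⟩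
  · obtain ⟨i, rfl⟩ := hx
    exact .inl ⟨i, y, hxy, ncard_eq_one_of_adj_of_notMem_range hbody hxy.symm hy, rfl⟩
  · obtain ⟨i, rfl⟩ := hy
    exact .inl ⟨i, x, hxy.symm, ncard_eq_one_of_adj_of_notMem_range hbody hxy hx, Sym2.eq_swap⟩
  · exact absurd hxy (not_adj_of_leaves hT (ncard_eq_one_of_adj_of_notMem_range hbody hxy hx)
      (ncard_eq_one_of_adj_of_notMem_range hbody hxy.symm hy) (ncard_body hbody ⟨0, hr⟩))

/-- Edges of a caterpillar can be ranked along the body: leaf edges at `v i` get rank `2 * i`, and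
the edge from `v i` to `v (i + 1)` gets rank `2 * i + 1`. -/
theorem exists_caterpillar_rank (hinj : Function.Injective v)
    (hbody : Set.range v = {w : Fin n | 2 ≤ (T.neighborSet w).ncard}) :
    ∃ ρ : Sym2 (Fin n) → ℕ,
      (∀ i w, T.Adj (v i) w → (T.neighborSet w).ncard = 1 → ρ s(v i, w) = 2 * i.val) ∧
      ∀ i j : Fin r, i.val + 1 = j.val → ρ s(v i, v j) = 2 * i.val + 1 := by
  have hpos : ∀ w, ∃ k : ℕ, (∀ i, w = v i → k = i.val) ∧
      ∀ i, T.Adj (v i) w → (T.neighborSet w).ncard = 1 → k = i.val := by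
    intro w
    by_cases h : ∃ i, w = v i
    · obtain ⟨i, rfl⟩ := h
      refine ⟨i, fun j hj => by rw [hinj hj], fun j _ h => ?_⟩
      have := ncard_body hbody i
      omega
    · by_cases h' : ∃ i, T.Adj (v i) w ∧ (T.neighborSet w).ncard = 1
      · obtain ⟨i, hi, hw⟩ := h'
        exact ⟨i, fun j hj => absurd ⟨j, hj⟩ h, fun j hj _ => by
          rw [hinj (eq_of_adj_of_ncard_eq_one hw hi.symm hj.symm)]⟩
      · exact ⟨0, fun j hj => absurd ⟨j, hj⟩ h, fun j hj hw => absurd ⟨j, hj, hw⟩ h'⟩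
  choose pos hpos₁ hpos₂ using hpos
  refine ⟨Sym2.lift ⟨fun x y => pos x + pos y, fun x y => add_comm _ _⟩, fun i w hw hl => ?_,
    fun i j hij => ?_⟩
  · change pos (v i) + pos w = _
    rw [hpos₁ _ i rfl, hpos₂ w i hw hl]
    ring
  · change pos (v i) + pos (v j) = _
    rw [hpos₁ _ i rfl, hpos₁ _ j rfl]
    omega

theorem caterpillar_edgesMeet_iff (hr : 0 < r) (hT : T.Connected) (hinj : Function.Injective v)
    (hbody : Set.range v = {w : Fin n | 2 ≤ (T.neighborSet w).ncard})
    (hadj : ∀ i j : Fin r, T.Adj (v i) (v j) ↔ (i.val + 1 = j.val ∨ j.val + 1 = i.val))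
    {ρ : Sym2 (Fin n) → ℕ}
    (hρleaf : ∀ i w, T.Adj (v i) w → (T.neighborSet w).ncard = 1 → ρ s(v i, w) = 2 * i.val)
    (hρbody : ∀ i j : Fin r, i.val + 1 = j.val → ρ s(v i, v j) = 2 * i.val + 1)
    {e f : Sym2 (Fin n)} (he : e ∈ T.edgeSet) (hf : f ∈ T.edgeSet) :
    EdgesMeet e f ↔ NoOddBetween (ρ e) (ρ f) := by
  have hmem : ∀ e ∈ T.edgeSet, ρ e + 2 ≤ 2 * r ∧
      ∀ i, v i ∈ e ↔ 2 * i.val ≤ ρ e + 1 ∧ ρ e ≤ 2 * i.val + 1 := by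
    intro e he
    rcases caterpillar_edge_cases hr hT hbody hadj he with ⟨j, w, hw, hl, rfl⟩ | ⟨j, k, hjk, rfl⟩
    · rw [hρleaf j w hw hl]
      refine ⟨by omega, fun i => ?_⟩
      have hne : v i ≠ w := by
        rintro rfl
        have := ncard_body hbody i
        omega
      rw [Sym2.mem_iff, hinj.eq_iff, Fin.ext_iff]
      simp only [hne, or_false]
      omega
    · rw [hρbody j k hjk]
      refine ⟨by omega, fun i => ?_⟩
      rw [Sym2.mem_iff, hinj.eq_iff, hinj.eq_iff, Fin.ext_iff, Fin.ext_iff]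
      omega
  constructor
  · rintro ⟨x, hxe, hxf⟩
    by_cases hx : x ∈ Set.range v
    · obtain ⟨i, rfl⟩ := hx
      have h1 := ((hmem e he).2 i).1 hxe
      have h2 := ((hmem f hf).2 i).1 hxf
      intro j
      omega
    · obtain ⟨a, rfl⟩ := hxe
      obtain ⟨b, rfl⟩ := hxf
      have hab : a = b := eq_of_adj_of_ncard_eq_one
        (ncard_eq_one_of_adj_of_notMem_range hbody he hx) he hf
      subst hab
      intro j
      omega
  · intro h
    wlog hle : ρ e ≤ ρ f generalizing e f
    · obtain ⟨x, hx⟩ := this hf he h.symm (by omega)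
      exact ⟨x, hx.symm⟩
    have h1 := hmem e he
    have h2 := hmem f hf
    have hi : (ρ e + 1) / 2 < r := by omega
    have := h ((ρ e + 1) / 2)
    exact ⟨v ⟨_, hi⟩, (h1.2 _).2 (by dsimp only; omega), (h2.2 _).2 (by dsimp only; omega)⟩

theorem exists_leaf_of_subsingleton_body_neighbors
    (hbody : Set.range v = {w : Fin n | 2 ≤ (T.neighborSet w).ncard}) (i : Fin r)
    (h : ∀ j k, T.Adj (v i) (v j) → T.Adj (v i) (v k) → j = k) :
    ∃ w, T.Adj (v i) w ∧ (T.neighborSet w).ncard = 1 := by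
  obtain ⟨a, ha, b, hb, hab⟩ :=
    (Set.one_lt_ncard (Set.toFinite _)).1 (ncard_body hbody i)
  by_cases ha' : a ∈ Set.range v
  · by_cases hb' : b ∈ Set.range v
    · obtain ⟨j, rfl⟩ := ha'
      obtain ⟨k, rfl⟩ := hb'
      exact absurd (congrArg v (h j k ha hb)) hab
    · exact ⟨b, hb, ncard_eq_one_of_adj_of_notMem_range hbody (T.adj_symm hb) hb'⟩
  · exact ⟨a, ha, ncard_eq_one_of_adj_of_notMem_range hbody (T.adj_symm ha) ha'⟩

end Caterpillar

/-- Corollary 3.3: for a caterpillar with body `v 0, …, v (r-1)` (the path,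
in path order, induced on the vertices of degree ≥ 2), with `lᵢ` leaves adjacent to
`v i`, the number of permutations arising from exactly one edge ordering is
`2·∏ lᵢ!` if `r > 1` and `l₀!` if `r = 1`. -/
theorem stmt7 (n r : ℕ) (hr : 0 < r) (T : SimpleGraph (Fin n)) (hT : T.IsTree)
    (v : Fin r → Fin n) (hinj : Function.Injective v)
    (hbody : Set.range v = {w : Fin n | 2 ≤ (T.neighborSet w).ncard})
    (hadj : ∀ i j : Fin r, T.Adj (v i) (v j) ↔ (i.val + 1 = j.val ∨ j.val + 1 = i.val)) :
    {c : Equiv.Perm (Fin n) | ∃! l, IsEdgeOrdering T l ∧ listProd l = c}.ncard =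
      if 1 < r then
        2 * ∏ i : Fin r,
          Nat.factorial {w : Fin n | T.Adj (v i) w ∧ (T.neighborSet w).ncard = 1}.ncard
      else
        Nat.factorial {w : Fin n | T.Adj (v ⟨0, hr⟩) w ∧ (T.neighborSet w).ncard = 1}.ncard := by
  classical
  obtain ⟨ρ, hρleaf, hρbody⟩ := exists_caterpillar_rank (T := T) hinj hbody
  have hcases := fun e (he : e ∈ T.edgeSet) =>
    caterpillar_edge_cases hr hT.connected hbody hadj he
  have hbodyEdge : ∀ i j : Fin r, i.val + 1 = j.val → s(v i, v j) ∈ T.edgeSet :=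
    fun i j hij => (hadj i j).2 (.inl hij)
  set S : Finset (Sym2 (Fin n)) := T.edgeSet.toFinset with hS
  have hmemS : ∀ e, e ∈ S ↔ e ∈ T.edgeSet := fun e => Set.mem_toFinset
  have hset : {l | IsEdgeOrdering T l ∧ l.IsChain EdgesMeet} =
      {l | (l.Nodup ∧ ∀ e, e ∈ l ↔ e ∈ S) ∧
        l.IsChain (fun e f => NoOddBetween (ρ e) (ρ f))} := by
    ext l
    simp only [IsEdgeOrdering, hmemS, Set.mem_ofPred_eq]
    refine and_congr_right fun hl => ?_
    have hmeet : ∀ e ∈ l, ∀ f ∈ l, EdgesMeet e f ↔ NoOddBetween (ρ e) (ρ f) :=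
      fun e he f hf => caterpillar_edgesMeet_iff hr hT.connected hinj hbody hadj hρleaf hρbody
        ((hl.2 e).1 he) ((hl.2 f).1 hf)
    simp only [List.isChain_iff_forall_rel_of_append_cons_cons]
    constructor <;> rintro h e f l₁ l₂ rfl
    · exact (hmeet e (by simp) f (by simp)).1 (h rfl)
    · exact (hmeet e (by simp) f (by simp)).2 (h rfl)
  have hfib : ∀ i : Fin r, (S.filter (fun e => ρ e = 2 * i.val)).card =
      {w : Fin n | T.Adj (v i) w ∧ (T.neighborSet w).ncard = 1}.ncard := by
    intro i
    have himage : (S.filter (fun e => ρ e = 2 * i.val) : Set (Sym2 (Fin n))) =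
        (fun w => s(v i, w)) '' {w : Fin n | T.Adj (v i) w ∧ (T.neighborSet w).ncard = 1} := by
      ext e
      simp only [Finset.coe_filter, hmemS, Set.mem_ofPred_eq, Set.mem_image]
      constructor
      · rintro ⟨he, hei⟩
        rcases hcases e he with ⟨j, w, hw, hl, rfl⟩ | ⟨j, k, hjk, rfl⟩
        · rw [hρleaf j w hw hl] at hei
          obtain rfl : j = i := Fin.ext (by omega)
          exact ⟨w, ⟨hw, hl⟩, rfl⟩
        · rw [hρbody j k hjk] at hei
          omega
      · rintro ⟨w, ⟨hw, hl⟩, rfl⟩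
        exact ⟨hw, hρleaf i w hw hl⟩
    rw [← Set.ncard_coe_finset, himage, Set.InjOn.ncard_image]
    exact fun a _ b _ hab => Sym2.congr_right.1 hab
  rw [ncard_existsUnique_edgeOrdering hT.isAcyclic, hset,
    ncard_isChain_noOddBetween ρ r hr S ?_ ?_ ?_ ?_ ?_]
  · rw [Finset.prod_range]
    simp only [hfib, ← hfib ⟨0, hr⟩]
  · intro e he
    rcases hcases e ((hmemS e).1 he) with ⟨j, w, hw, hl, rfl⟩ | ⟨j, k, hjk, rfl⟩
    · rw [hρleaf j w hw hl]
      omega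
    · rw [hρbody j k hjk]
      omega
  · intro i hi
    exact ⟨s(v ⟨i, by omega⟩, v ⟨i + 1, hi⟩), (hmemS _).2 (hbodyEdge _ _ rfl), hρbody _ _ rfl⟩
  · have hodd : ∀ i, ∀ e ∈ S, ρ e = 2 * i + 1 →
        ∃ j k : Fin r, j.val = i ∧ k.val = i + 1 ∧ e = s(v j, v k) := by
      intro i e he hei
      rcases hcases e ((hmemS e).1 he) with ⟨j, w, hw, hl, rfl⟩ | ⟨j, k, hjk, rfl⟩
      · rw [hρleaf j w hw hl] at hei
        omega
      · rw [hρbody j k hjk] at hei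
        exact ⟨j, k, by omega, by omega, rfl⟩
    intro i e he f hf hei hfi
    obtain ⟨j, k, hj, hk, rfl⟩ := hodd i e he hei
    obtain ⟨j', k', hj', hk', rfl⟩ := hodd i f hf hfi
    obtain rfl : j = j' := Fin.ext (by omega)
    obtain rfl : k = k' := Fin.ext (by omega)
    rfl
  · intro h
    obtain ⟨w, hw, hl⟩ := exists_leaf_of_subsingleton_body_neighbors hbody ⟨0, hr⟩
      (fun j k hj hk => Fin.ext (by
        have h1 := (hadj _ _).1 hj
        have h2 := (hadj _ _).1 hk
        dsimp only at h1 h2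
        omega))
    exact ⟨_, (hmemS s(_, w)).2 hw, hρleaf _ w hw hl⟩
  · intro h
    obtain ⟨w, hw, hl⟩ := exists_leaf_of_subsingleton_body_neighbors hbody ⟨r - 1, by omega⟩
      (fun j k hj hk => Fin.ext (by
        have h1 := (hadj _ _).1 hj
        have h2 := (hadj _ _).1 hk
        dsimp only at h1 h2
        omega))
    refine ⟨_, (hmemS s(_, w)).2 hw, ?_⟩
    rw [hρleaf _ w hw hl]
    dsimp only
    omega
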